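/- Let a ≥ 0, b ≥ 1 and let E ⊆ ⋃_{n≥1} B_n^{a,b} be a stable set. The following are equivalent: (i) for every 1 < p < ∞, lim_n n^{1/p − 1}·α_{p,n}(E) = 0; (ii) for some 1 < p < ∞, lim_n n^{1/p − 1}·α_{p,n}(E) = 0; (iii) lim_n θ_n(E) = 0; (iv) for every ϱ > 0 there exists N ∈ ℕ such that for all n ≥ N, E ∩ B_n^{a,b} contains no ϱ-ℓ₁⁺-sequence. -/

import Mathlib

open scoped BigOperators ENNReal

noncomputable section

namespace AsymSeminorms

variable {𝕜 : Type*} [RCLike 𝕜]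

/-- A pair of seminorms on `𝕜^n`, used to encode a (finite) basic sequence together with
the seminorm induced by an operator. -/
abbrev SNPair (𝕜 : Type*) [RCLike 𝕜] (n : ℕ) : Type _ :=
  Seminorm 𝕜 (Fin n → 𝕜) × Seminorm 𝕜 (Fin n → 𝕜)

/-- Truncation of a vector in `𝕜^n` to its first `m` coordinates (the rest set to `0`);
this encodes `∑_{i=1}^m a_i e_i`. -/
def trunc {n : ℕ} (m : ℕ) (a : Fin n → 𝕜) : Fin n → 𝕜 :=
  fun i => if (i : ℕ) < m then a i else 0

/-- Membership in the set `B_n^{a,b}` (here the constants are called `ca`, `cb`):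
`r = P.1` is a norm with `r(e_i) = 1`, both seminorms satisfy the `b`-basis inequality for
truncations, and `ρ = P.2` satisfies `ρ ≤ a·r`. -/
structure MemB (ca cb : ℝ) {n : ℕ} (P : SNPair 𝕜 n) : Prop where
  eq_zero_of : ∀ x : Fin n → 𝕜, P.1 x = 0 → x = 0
  single_eq_one : ∀ i : Fin n, P.1 (Pi.single i 1) = 1
  trunc_fst : ∀ m : ℕ, m ≤ n → ∀ a : Fin n → 𝕜, P.1 (trunc m a) ≤ cb * P.1 a
  trunc_snd : ∀ m : ℕ, m ≤ n → ∀ a : Fin n → 𝕜, P.2 (trunc m a) ≤ cb * P.2 a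
  snd_le : ∀ x : Fin n → 𝕜, P.2 x ≤ ca * P.1 x

/-- The metric `d_n` on `B_n^{a,b}`: the supremum, over coefficient vectors in the unit ball
of `ℓ_∞^n`, of the maximal deviation of the two seminorms. -/
def dB {n : ℕ} (P Q : SNPair 𝕜 n) : ℝ :=
  sSup {x : ℝ | ∃ a : Fin n → 𝕜, (∀ i, ‖a i‖ ≤ 1) ∧
      x = max |P.1 a - Q.1 a| |P.2 a - Q.2 a|}

/-- A family `E`, with `E n` a set of pairs of seminorms on `𝕜^n`; this encodes a subset of
`⋃_{n≥1} B_n^{a,b}`. -/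
abbrev Fam (𝕜 : Type*) [RCLike 𝕜] : Type _ := ∀ n : ℕ, Set (SNPair 𝕜 n)

/-- `E ⊆ ⋃_n B_n^{a,b}`. -/
def SubB (ca cb : ℝ) (E : Fam 𝕜) : Prop := ∀ n, ∀ P ∈ E n, MemB ca cb P

/-- `E` is closed: each `E ∩ B_n^{a,b}` is closed in `B_n^{a,b}` for the metric `d_n`. -/
def ClosedFam (ca cb : ℝ) (E : Fam 𝕜) : Prop :=
  ∀ n, ∀ P : SNPair 𝕜 n, MemB ca cb P →
    (∀ ε : ℝ, 0 < ε → ∃ Q ∈ E n, dB P Q < ε) → P ∈ E n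

/-- The `j`-th block piece: the vector `∑_{k_j < i ≤ k_{j+1}} a_i e_i` (with `0`-based
indexing of the cut points `k`). -/
def piece {n m : ℕ} (a : Fin n → 𝕜) (k : Fin (m + 1) → ℕ) (j : Fin m) : Fin n → 𝕜 :=
  fun i => if k j.castSucc ≤ (i : ℕ) ∧ (i : ℕ) < k j.succ then a i else 0

/-- `(s,σ) = Q` is a block of `(r,ρ) = P`. -/
def IsBlockOf {n m : ℕ} (P : SNPair 𝕜 n) (Q : SNPair 𝕜 m) : Prop :=
  ∃ (a : Fin n → 𝕜) (k : Fin (m + 1) → ℕ),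
    k 0 = 0 ∧ StrictMono k ∧ k (Fin.last m) ≤ n ∧
    (∀ j : Fin m, P.1 (piece a k j) = 1) ∧
    (∀ b : Fin m → 𝕜, Q.1 b = P.1 (∑ j : Fin m, b j • piece a k j)) ∧
    (∀ b : Fin m → 𝕜, Q.2 b = P.2 (∑ j : Fin m, b j • piece a k j))

/-- `E` contains all blocks of its members (that lie in the corresponding `B_m^{a,b}`). -/
def BlockClosedFam (ca cb : ℝ) (E : Fam 𝕜) : Prop :=
  ∀ n m : ℕ, ∀ P ∈ E n, ∀ Q : SNPair 𝕜 m, MemB ca cb Q → IsBlockOf P Q → Q ∈ E m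

/-- `E ⊆ ⋃_n B_n^{a,b}` is stable: closed and block closed. -/
def StableFam (ca cb : ℝ) (E : Fam 𝕜) : Prop :=
  SubB ca cb E ∧ ClosedFam ca cb E ∧ BlockClosedFam ca cb E

/-- `E` is an identity block: stable and `r = ρ` for each member. -/
def IdentityBlockFam (ca cb : ℝ) (E : Fam 𝕜) : Prop :=
  StableFam ca cb E ∧ ∀ n, ∀ P ∈ E n, P.1 = P.2

/-- The `ℓ_p^n` norm of a coefficient vector, `1 ≤ p ≤ ∞`. -/
def lpnorm (p : ℝ≥0∞) {n : ℕ} (a : Fin n → 𝕜) : ℝ :=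
  if p = ∞ then ⨆ i, ‖a i‖ else (∑ i, ‖a i‖ ^ p.toReal) ^ (1 / p.toReal)

/-- The sign `±1 ∈ 𝕜` associated to a Boolean. -/
def sgn (b : Bool) : 𝕜 := if b then 1 else -1

/-- The `L_p` norm of a real function of `n` independent Rademacher variables, i.e. of a
function on `{±1}^n` with the uniform probability measure. -/
def radLp (p : ℝ≥0∞) {n : ℕ} (F : (Fin n → Bool) → ℝ) : ℝ :=
  if p = ∞ then ⨆ ε : Fin n → Bool, |F ε|
  else ((∑ ε : Fin n → Bool, |F ε| ^ p.toReal) / 2 ^ n) ^ (1 / p.toReal)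

/-- `α_{p,n}(E)`: the infimum of the constants `T > 0` such that
`ρ(∑ a_i e_i) ≤ T ‖(a_i)‖_{ℓ_p^n}` for all `(r,ρ) ∈ E ∩ B_n^{a,b}`. -/
def alphaC (p : ℝ≥0∞) (E : Fam 𝕜) (n : ℕ) : ℝ :=
  sInf {T : ℝ | 0 < T ∧ ∀ P ∈ E n, ∀ a : Fin n → 𝕜, P.2 a ≤ T * lpnorm p a}

/-- `β_{q,n}(E)`: the infimum of the constants `C > 0` such that
`C r(∑ a_i e_i) ≥ ‖(a_i ρ(e_i))‖_{ℓ_q^n}` for all `(r,ρ) ∈ E ∩ B_n^{a,b}`. -/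
def betaC (q : ℝ≥0∞) (E : Fam 𝕜) (n : ℕ) : ℝ :=
  sInf {C : ℝ | 0 < C ∧ ∀ P ∈ E n, ∀ a : Fin n → 𝕜,
    lpnorm q (fun i => a i * ((P.2 (Pi.single i 1) : ℝ) : 𝕜)) ≤ C * P.1 a}

/-- `τ_{p,n}(E)`: the infimum of the constants `T > 0` such that
`‖ρ(∑ ε_i a_i e_i)‖_{L_p} ≤ T ‖(a_i)‖_{ℓ_p^n}` for all `(r,ρ) ∈ E ∩ B_n^{a,b}`. -/
def tauC (p : ℝ≥0∞) (E : Fam 𝕜) (n : ℕ) : ℝ :=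
  sInf {T : ℝ | 0 < T ∧ ∀ P ∈ E n, ∀ a : Fin n → 𝕜,
    radLp p (fun ε => P.2 (fun i => sgn (ε i) * a i)) ≤ T * lpnorm p a}

/-- `γ_{q,n}(E)`: the infimum of the constants `C > 0` such that
`C ‖r(∑ ε_i a_i e_i)‖_{L_q} ≥ ‖(a_i ρ(e_i))‖_{ℓ_q^n}` for all `(r,ρ) ∈ E ∩ B_n^{a,b}`. -/
def gammaC (q : ℝ≥0∞) (E : Fam 𝕜) (n : ℕ) : ℝ :=
  sInf {C : ℝ | 0 < C ∧ ∀ P ∈ E n, ∀ a : Fin n → 𝕜,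
    lpnorm q (fun i => a i * ((P.2 (Pi.single i 1) : ℝ) : 𝕜)) ≤
      C * radLp q (fun ε => P.1 (fun i => sgn (ε i) * a i))}

/-- `θ_n(E)`: the infimum of the constants `T > 0` such that
`ρ((1/n) ∑ a_i e_i) ≤ T ‖(a_i)‖_{ℓ_∞^n}` for all `(r,ρ) ∈ E ∩ B_n^{a,b}`. -/
def thetaC (E : Fam 𝕜) (n : ℕ) : ℝ :=
  sInf {T : ℝ | 0 < T ∧ ∀ P ∈ E n, ∀ a : Fin n → 𝕜,
    P.2 ((n : 𝕜)⁻¹ • a) ≤ T * lpnorm ∞ a}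

/-- `Θ_n(E)`: the infimum of the constants `T > 0` such that
`‖ρ((1/n) ∑ ε_i a_i e_i)‖_{L_1} ≤ T ‖(a_i)‖_{ℓ_∞^n}` for all `(r,ρ) ∈ E ∩ B_n^{a,b}`. -/
def bigThetaC (E : Fam 𝕜) (n : ℕ) : ℝ :=
  sInf {T : ℝ | 0 < T ∧ ∀ P ∈ E n, ∀ a : Fin n → 𝕜,
    radLp 1 (fun ε => P.2 ((n : 𝕜)⁻¹ • fun i => sgn (ε i) * a i)) ≤ T * lpnorm ∞ a}

/-- `υ_n(E)`: the infimum of the constants `C > 0` such that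
`C r(∑ a_i e_i) ≥ min_i |a_i| ρ(e_i)` for all `(r,ρ) ∈ E ∩ B_n^{a,b}`. -/
def upsC (E : Fam 𝕜) (n : ℕ) : ℝ :=
  sInf {C : ℝ | 0 < C ∧ ∀ P ∈ E n, ∀ a : Fin n → 𝕜,
    (⨅ i, ‖a i‖ * P.2 (Pi.single i 1)) ≤ C * P.1 a}

/-- `Υ_n(E)`: the infimum of the constants `C > 0` such that
`C ‖r(∑ ε_i a_i e_i)‖_{L_1} ≥ min_i |a_i| ρ(e_i)` for all `(r,ρ) ∈ E ∩ B_n^{a,b}`. -/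
def bigUpsC (E : Fam 𝕜) (n : ℕ) : ℝ :=
  sInf {C : ℝ | 0 < C ∧ ∀ P ∈ E n, ∀ a : Fin n → 𝕜,
    (⨅ i, ‖a i‖ * P.2 (Pi.single i 1)) ≤
      C * radLp 1 (fun ε => P.1 (fun i => sgn (ε i) * a i))}

end AsymSeminorms

namespace AsymSeminorms

/-- A `ϱ`-`ℓ₁⁺`-sequence: `ρ(∑ a_i e_i) ≥ ϱ ∑ a_i` for all nonnegative scalars `(a_i)`. -/
def IsL1PlusSeq {𝕜 : Type*} [RCLike 𝕜] (ϱ : ℝ) {n : ℕ} (P : SNPair 𝕜 n) : Prop :=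
  ∀ a : Fin n → ℝ, (∀ i, 0 ≤ a i) → ϱ * ∑ i, a i ≤ P.2 (fun i => (a i : 𝕜))

section

variable {𝕜 : Type*} [RCLike 𝕜]

/-- **Hahn–Banach**: at each vector a seminorm is attained by a linear functional it dominates. -/
theorem exists_linearMap_norm_le_seminorm {F : Type*} [AddCommGroup F] [Module 𝕜 F]
    (p : Seminorm 𝕜 F) (x : F) :
    ∃ f : F →ₗ[𝕜] 𝕜, (∀ y, ‖f y‖ ≤ p y) ∧ f x = (p x : 𝕜) := by
  let _ : SeminormedAddCommGroup F := p.toAddGroupSeminorm.toSeminormedAddCommGroup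
  let _ : NormedSpace 𝕜 F := { norm_smul_le := fun c y => (map_smul_eq_mul p c y).le }
  obtain ⟨g, hg, hgx⟩ := exists_dual_vector'' 𝕜 x
  exact ⟨g.toLinearMap, fun y => (g.le_of_opNorm_le hg y).trans (one_mul _).le, hgx⟩

theorem linearMap_apply_eq_sum {n : ℕ} (f : (Fin n → 𝕜) →ₗ[𝕜] 𝕜) (a : Fin n → 𝕜) :
    f a = ∑ i, a i * f (Pi.single i 1) := by
  conv_lhs => rw [← LinearMap.sum_single_apply (fun _ : Fin n => 𝕜) a, map_sum]
  refine Finset.sum_congr rfl fun i _ => ?_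
  rw [← smul_eq_mul, ← map_smul, ← Pi.single_smul, smul_eq_mul, mul_one]

theorem MemB.snd_single_le {ca cb : ℝ} {n : ℕ} {P : SNPair 𝕜 n} (hP : MemB ca cb P) (i : Fin n) :
    P.2 (Pi.single i 1) ≤ ca := by
  simpa [hP.single_eq_one i] using hP.snd_le (Pi.single i 1)

theorem MemB.snd_le_sum {ca cb : ℝ} {n : ℕ} {P : SNPair 𝕜 n} (hP : MemB ca cb P)
    (a : Fin n → 𝕜) : P.2 a ≤ ca * ∑ i, ‖a i‖ := by
  obtain ⟨f, hf, hfa⟩ := exists_linearMap_norm_le_seminorm P.2 a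
  calc P.2 a ≤ ‖f a‖ := by rw [hfa]; simpa using le_abs_self _
    _ ≤ ∑ i, ‖a i * f (Pi.single i 1)‖ := by
      rw [linearMap_apply_eq_sum]; exact norm_sum_le _ _
    _ ≤ ∑ i, ca * ‖a i‖ := Finset.sum_le_sum fun i _ => by
      rw [norm_mul, mul_comm]
      exact mul_le_mul_of_nonneg_right ((hf _).trans (hP.snd_single_le i)) (norm_nonneg _)
    _ = ca * ∑ i, ‖a i‖ := (Finset.mul_sum _ _ _).symm

/-- The linear embedding `𝕜^m → 𝕜^n` sending `e_j` to `u_j e_{φ j}`. -/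
def weightedEmb {n m : ℕ} (φ : Fin m ↪o Fin n) (u : Fin m → 𝕜) :
    (Fin m → 𝕜) →ₗ[𝕜] (Fin n → 𝕜) :=
  ∑ j, (LinearMap.single 𝕜 (fun _ => 𝕜) (φ j)).comp (u j • LinearMap.proj j)

theorem weightedEmb_apply {n m : ℕ} (φ : Fin m ↪o Fin n) (u b : Fin m → 𝕜) (i : Fin n) :
    weightedEmb φ u b i = ∑ j, if i = φ j then u j * b j else 0 := by
  simp [weightedEmb, Pi.single_apply]

theorem weightedEmb_apply_emb {n m : ℕ} (φ : Fin m ↪o Fin n) (u b : Fin m → 𝕜) (j : Fin m) :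
    weightedEmb φ u b (φ j) = u j * b j := by
  simp [weightedEmb_apply]

theorem weightedEmb_single {n m : ℕ} (φ : Fin m ↪o Fin n) (u : Fin m → 𝕜) (j : Fin m) :
    weightedEmb φ u (Pi.single j 1) = u j • (Pi.single (φ j) 1 : Fin n → 𝕜) := by
  ext i
  rw [weightedEmb_apply, Finset.sum_eq_single j]
  · simp [Pi.single_apply]
  · intro l _ hl
    simp [hl]
  · simp

theorem exists_trunc_weightedEmb {n m : ℕ} (φ : Fin m ↪o Fin n) (u : Fin m → 𝕜) (l : ℕ) :
    ∃ M ≤ n, ∀ b, weightedEmb φ u (trunc l b) = trunc M (weightedEmb φ u b) := by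
  have key : ∀ M : ℕ, (∀ j, (φ j : ℕ) < M ↔ (j : ℕ) < l) →
      ∀ b, weightedEmb φ u (trunc l b) = trunc M (weightedEmb φ u b) := by
    intro M hM b
    ext i
    simp only [trunc, weightedEmb_apply]
    split_ifs with hi
    · refine Finset.sum_congr rfl fun j _ => if_ctx_congr Iff.rfl (fun hij => ?_) fun _ => rfl
      rw [if_pos ((hM j).mp (hij ▸ hi))]
    · refine Finset.sum_eq_zero fun j _ => ?_
      split_ifs with hij hj
      · exact absurd (hij ▸ (hM j).mpr hj) hi
      · exact mul_zero _
      · rfl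
  by_cases hl : l < m
  · exact ⟨φ ⟨l, hl⟩, (φ ⟨l, hl⟩).2.le, key _ fun j => by
      rw [← Fin.lt_def, φ.lt_iff_lt, Fin.lt_def]⟩
  · exact ⟨n, le_rfl, key _ fun j => by simpa using j.2.trans_le (not_lt.mp hl)⟩

/-- The pair induced on `𝕜^m` by the vectors `u_j e_{φ j}`. -/
def subPair {n m : ℕ} (P : SNPair 𝕜 n) (φ : Fin m ↪o Fin n) (u : Fin m → 𝕜) : SNPair 𝕜 m :=
  (P.1.comp (weightedEmb φ u), P.2.comp (weightedEmb φ u))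

theorem MemB.subPair {ca cb : ℝ} {n m : ℕ} {P : SNPair 𝕜 n} (hP : MemB ca cb P)
    (φ : Fin m ↪o Fin n) {u : Fin m → 𝕜} (hu : ∀ j, ‖u j‖ = 1) :
    MemB ca cb (subPair P φ u) where
  eq_zero_of x hx := by
    ext j
    have h := congrFun (hP.eq_zero_of _ hx) (φ j)
    rw [weightedEmb_apply_emb] at h
    have huj : u j ≠ 0 := norm_ne_zero_iff.mp (by simp [hu])
    simpa [huj] using h
  single_eq_one j := by
    change P.1 (weightedEmb φ u _) = 1
    rw [weightedEmb_single, map_smul_eq_mul, hu, hP.single_eq_one, one_mul]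
  trunc_fst l _ a := by
    obtain ⟨M, hM, h⟩ := exists_trunc_weightedEmb φ u l
    change P.1 (weightedEmb φ u _) ≤ _
    rw [h]
    exact hP.trunc_fst M hM _
  trunc_snd l _ a := by
    obtain ⟨M, hM, h⟩ := exists_trunc_weightedEmb φ u l
    change P.2 (weightedEmb φ u _) ≤ _
    rw [h]
    exact hP.trunc_snd M hM _
  snd_le x := hP.snd_le _

theorem MemB.isBlockOf_subPair {ca cb : ℝ} {n m : ℕ} {P : SNPair 𝕜 n} (hP : MemB ca cb P)
    (φ : Fin m ↪o Fin n) {u : Fin m → 𝕜} (hu : ∀ j, ‖u j‖ = 1) :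
    IsBlockOf P (AsymSeminorms.subPair P φ u) := by
  let k : Fin (m + 1) → ℕ := Fin.cons 0 fun j => (φ j : ℕ) + 1
  have hk : StrictMono k := by
    rw [Fin.strictMono_iff_lt_succ]
    intro j
    obtain _ | m := m
    · exact j.elim0
    · induction j using Fin.cases with
      | zero => simp [k]
      | succ j =>
        simp only [k, ← Fin.succ_castSucc, Fin.cons_succ]
        have : φ j.castSucc < φ j.succ := φ.lt_iff_lt.mpr j.castSucc_lt_succ
        exact Nat.succ_lt_succ this
  have hpiece : ∀ j, piece (weightedEmb φ u 1) k j = u j • (Pi.single (φ j) 1 : Fin n → 𝕜) := by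
    intro j
    ext i
    by_cases hi : i = φ j
    · subst hi
      have : k j.castSucc ≤ (φ j : ℕ) := by
        have := hk j.castSucc_lt_succ
        simpa [k, Nat.lt_succ_iff] using this
      simp [piece, weightedEmb_apply_emb, this, k]
    · have hne : ∀ l, k j.castSucc ≤ (i : ℕ) ∧ (i : ℕ) < k j.succ → i ≠ φ l := by
        rintro l ⟨h1, h2⟩ rfl
        have hkl : k l.succ = (φ l : ℕ) + 1 := by simp [k]
        have h3 : j.castSucc < l.succ := hk.lt_iff_lt.mp (by omega)
        have h4 : k l.succ ≤ k j.succ := by omega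
        have h5 := hk.le_iff_le.mp h4
        apply hi
        have hlj : l = j :=
          le_antisymm (Fin.succ_le_succ_iff.mp h5) (Fin.castSucc_lt_succ_iff.mp h3)
        rw [hlj]
      have : (u j • Pi.single (φ j) (1 : 𝕜) : Fin n → 𝕜) i = 0 := by simp [hi]
      rw [this]
      simp only [piece]
      split_ifs with h
      · rw [weightedEmb_apply]
        exact Finset.sum_eq_zero fun l _ => if_neg (hne l h)
      · rfl
  have hsum : ∀ b : Fin m → 𝕜,
      weightedEmb φ u b = ∑ j, b j • piece (weightedEmb φ u 1) k j := by
    intro b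
    ext i
    simp only [weightedEmb_apply, hpiece, Finset.sum_apply, Pi.smul_apply, Pi.single_apply,
      smul_eq_mul]
    exact Finset.sum_congr rfl fun j _ => by split_ifs <;> ring
  refine ⟨weightedEmb φ u 1, k, rfl, hk, ?_, fun j => ?_, fun b => ?_, fun b => ?_⟩
  · obtain _ | m := m
    · simp [k]
    · rw [← Fin.succ_last]
      exact (φ (Fin.last m)).2
  · rw [hpiece, map_smul_eq_mul, hu, hP.single_eq_one, one_mul]
  · rw [← hsum]; rfl
  · rw [← hsum]; rfl

/-- A functional dominated by `ρ` which is at least `δ` in modulus on the `e_i`, `i ∈ J`,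
produces a `δ`-`ℓ₁⁺`-sequence of length `#J`. -/
theorem StableFam.exists_isL1PlusSeq {ca cb : ℝ} {E : Fam 𝕜} (hE : StableFam ca cb E) {n : ℕ}
    {P : SNPair 𝕜 n} (hP : P ∈ E n) {f : (Fin n → 𝕜) →ₗ[𝕜] 𝕜} (hf : ∀ x, ‖f x‖ ≤ P.2 x)
    {δ : ℝ} (hδ : 0 < δ) {J : Finset (Fin n)} (hJ : ∀ i ∈ J, δ ≤ ‖f (Pi.single i 1)‖) :
    ∃ Q ∈ E J.card, IsL1PlusSeq δ Q := by
  let φ := J.orderEmbOfFin rfl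
  have hφ : ∀ j, δ ≤ ‖f (Pi.single (φ j) 1)‖ := fun j => hJ _ (J.orderEmbOfFin_mem rfl j)
  have hu : ∀ j, ∃ u : 𝕜, ‖u‖ = 1 ∧
      u * f (Pi.single (φ j) 1) = (‖f (Pi.single (φ j) 1)‖ : 𝕜) := by
    intro j
    have h0 : f (Pi.single (φ j) 1) ≠ 0 := norm_pos_iff.mp (hδ.trans_le (hφ j))
    refine ⟨‖f (Pi.single (φ j) 1)‖ / f (Pi.single (φ j) 1), ?_, div_mul_cancel₀ _ h0⟩
    simp [h0]
  choose u hu1 hu2 using hu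
  have hPB := hE.1 n P hP
  refine ⟨AsymSeminorms.subPair P φ u, hE.2.2 n _ P hP _ (hPB.subPair φ hu1)
    (hPB.isBlockOf_subPair φ hu1), fun c hc => ?_⟩
  have hval : f (weightedEmb φ u fun j => (c j : 𝕜)) =
      ((∑ j, c j * ‖f (Pi.single (φ j) 1)‖ : ℝ) : 𝕜) := by
    have h := linearMap_apply_eq_sum (f.comp (weightedEmb φ u)) fun j => (c j : 𝕜)
    rw [LinearMap.comp_apply] at h
    rw [h]
    push_cast
    refine Finset.sum_congr rfl fun j _ => ?_
    rw [Function.comp_apply, weightedEmb_single, map_smul, smul_eq_mul, hu2]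
  calc δ * ∑ j, c j = ∑ j, c j * δ := by rw [mul_comm, Finset.sum_mul]
    _ ≤ ∑ j, c j * ‖f (Pi.single (φ j) 1)‖ :=
      Finset.sum_le_sum fun j _ => mul_le_mul_of_nonneg_left (hφ j) (hc j)
    _ ≤ ‖f (weightedEmb φ u fun j => (c j : 𝕜))‖ := by
      rw [hval, RCLike.norm_ofReal]; exact le_abs_self _
    _ ≤ P.2 (weightedEmb φ u fun j => (c j : 𝕜)) := hf _

theorem lpnorm_ofReal {p : ℝ} (hp : 1 < p) {n : ℕ} (a : Fin n → 𝕜) :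
    lpnorm (ENNReal.ofReal p) a = (∑ i, ‖a i‖ ^ p) ^ (1 / p) := by
  simp [lpnorm, ENNReal.toReal_ofReal (zero_le_one.trans hp.le)]

theorem lpnorm_ofReal_nonneg {p : ℝ} (hp : 1 < p) {n : ℕ} (a : Fin n → 𝕜) :
    0 ≤ lpnorm (ENNReal.ofReal p) a := by
  rw [lpnorm_ofReal hp]
  positivity

theorem norm_le_lpnorm {p : ℝ} (hp : 1 < p) {n : ℕ} (a : Fin n → 𝕜) (i : Fin n) :
    ‖a i‖ ≤ lpnorm (ENNReal.ofReal p) a := by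
  have hp0 : 0 < p := zero_lt_one.trans hp
  rw [lpnorm_ofReal hp, one_div, Real.le_rpow_inv_iff_of_pos (norm_nonneg _) (by positivity) hp0]
  exact Finset.single_le_sum (f := fun i => ‖a i‖ ^ p) (fun _ _ => by positivity)
    (Finset.mem_univ i)

theorem sum_norm_le_lpnorm {p : ℝ} (hp : 1 < p) {n : ℕ} (a : Fin n → 𝕜) :
    ∑ i, ‖a i‖ ≤ (n : ℝ) ^ (1 - 1 / p) * lpnorm (ENNReal.ofReal p) a := by
  have hp0 : 0 < p := zero_lt_one.trans hp
  have h := Real.rpow_sum_le_const_mul_sum_rpow_of_nonneg (s := Finset.univ)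
    (f := fun i => ‖a i‖) hp.le fun i _ => norm_nonneg _
  rw [Finset.card_univ, Fintype.card_fin] at h
  have hexp : 1 - 1 / p = (p - 1) * p⁻¹ := by field_simp
  rw [lpnorm_ofReal hp, hexp, Real.rpow_mul (by positivity), one_div,
    ← Real.mul_rpow (by positivity) (by positivity),
    Real.le_rpow_inv_iff_of_pos (by positivity) (by positivity) hp0]
  exact h

theorem lpnorm_le_of_norm_le {p : ℝ} (hp : 1 < p) {n : ℕ} {a : Fin n → 𝕜} {M : ℝ} (hM : 0 ≤ M)
    (ha : ∀ i, ‖a i‖ ≤ M) : lpnorm (ENNReal.ofReal p) a ≤ (n : ℝ) ^ (1 / p) * M := by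
  have hp0 : 0 < p := zero_lt_one.trans hp
  rw [lpnorm_ofReal hp]
  calc (∑ i, ‖a i‖ ^ p) ^ (1 / p) ≤ (∑ _i : Fin n, M ^ p) ^ (1 / p) := by
        gcongr with i
        exact ha i
    _ = (n : ℝ) ^ (1 / p) * M := by
      rw [Finset.sum_const, Finset.card_univ, Fintype.card_fin, nsmul_eq_mul,
        Real.mul_rpow (by positivity) (by positivity), one_div, Real.rpow_rpow_inv hM hp0.ne']

theorem norm_le_lpnorm_top {n : ℕ} (a : Fin n → 𝕜) (i : Fin n) : ‖a i‖ ≤ lpnorm ∞ a := by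
  rw [lpnorm, if_pos rfl]
  exact le_ciSup (f := fun i => ‖a i‖) (Set.finite_range _).bddAbove i

theorem lpnorm_top_nonneg {n : ℕ} (a : Fin n → 𝕜) : 0 ≤ lpnorm ∞ a := by
  rw [lpnorm, if_pos rfl]
  exact Real.iSup_nonneg fun i => norm_nonneg _

theorem alphaC_nonneg (p : ℝ≥0∞) (E : Fam 𝕜) (n : ℕ) : 0 ≤ alphaC p E n :=
  Real.sInf_nonneg fun _ hT => hT.1.le

theorem thetaC_nonneg (E : Fam 𝕜) (n : ℕ) : 0 ≤ thetaC E n :=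
  Real.sInf_nonneg fun _ hT => hT.1.le

theorem thetaC_le_alphaC {ca cb : ℝ} (hca : 0 ≤ ca) {E : Fam 𝕜} (hE : SubB ca cb E) {p : ℝ}
    (hp : 1 < p) {n : ℕ} (hn : 0 < n) :
    thetaC E n ≤ (n : ℝ) ^ (1 / p - 1) * alphaC (ENNReal.ofReal p) E n := by
  have hn' : (0 : ℝ) < n := Nat.cast_pos.mpr hn
  have hpow : (0 : ℝ) < (n : ℝ) ^ (1 / p - 1) := Real.rpow_pos_of_pos hn' _
  rw [← div_le_iff₀' hpow]
  refine le_csInf ⟨ca * n + 1, by positivity, fun P hP a => ?_⟩ fun T hT => ?_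
  · have hsum : ∑ i, ‖a i‖ ≤ n * lpnorm (ENNReal.ofReal p) a := by
      simpa using Finset.sum_le_card_nsmul Finset.univ (fun i => ‖a i‖) _
        fun i _ => norm_le_lpnorm hp a i
    calc P.2 a ≤ ca * ∑ i, ‖a i‖ := (hE n P hP).snd_le_sum a
      _ ≤ ca * (n * lpnorm (ENNReal.ofReal p) a) := by gcongr
      _ ≤ (ca * n + 1) * lpnorm (ENNReal.ofReal p) a := by
        linarith [lpnorm_ofReal_nonneg hp a]
  · rw [div_le_iff₀' hpow]
    refine csInf_le ⟨0, fun S hS => hS.1.le⟩ ⟨mul_pos hpow hT.1, fun P hP a => ?_⟩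
    rw [map_smul_eq_mul, norm_inv, RCLike.norm_natCast]
    calc (n : ℝ)⁻¹ * P.2 a ≤ (n : ℝ)⁻¹ * (T * ((n : ℝ) ^ (1 / p) * lpnorm ∞ a)) := by
          gcongr
          exact (hT.2 P hP a).trans (mul_le_mul_of_nonneg_left
            (lpnorm_le_of_norm_le hp (lpnorm_top_nonneg a) (norm_le_lpnorm_top a)) hT.1.le)
      _ = (n : ℝ) ^ (1 / p - 1) * T * lpnorm ∞ a := by
        rw [Real.rpow_sub_one hn'.ne']
        ring

theorem IsL1PlusSeq.le_thetaC {ca cb : ℝ} (hca : 0 ≤ ca) {E : Fam 𝕜} (hE : SubB ca cb E) {n : ℕ}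
    (hn : 0 < n) {P : SNPair 𝕜 n} (hP : P ∈ E n) {ϱ : ℝ} (h : IsL1PlusSeq ϱ P) :
    ϱ ≤ thetaC E n := by
  have hn' : (0 : ℝ) < n := Nat.cast_pos.mpr hn
  refine le_csInf ⟨ca + 1, by positivity, fun Q hQ a => ?_⟩ fun T hT => ?_
  · have hsum : ∑ i, ‖a i‖ ≤ n * lpnorm ∞ a := by
      simpa using Finset.sum_le_card_nsmul Finset.univ (fun i => ‖a i‖) _
        fun i _ => norm_le_lpnorm_top a i
    rw [map_smul_eq_mul, norm_inv, RCLike.norm_natCast]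
    calc (n : ℝ)⁻¹ * Q.2 a ≤ (n : ℝ)⁻¹ * (ca * (n * lpnorm ∞ a)) := by
          gcongr
          exact ((hE n Q hQ).snd_le_sum a).trans (mul_le_mul_of_nonneg_left hsum hca)
      _ = ca * lpnorm ∞ a := by field_simp
      _ ≤ (ca + 1) * lpnorm ∞ a := by linarith [lpnorm_top_nonneg a]
  · have : Nonempty (Fin n) := ⟨⟨0, hn⟩⟩
    have h1 := h (fun _ => (n : ℝ)⁻¹) fun _ => by positivity
    have h2 := hT.2 P hP fun _ => 1
    have h3 : ((n : 𝕜)⁻¹ • fun _ => 1 : Fin n → 𝕜) = fun _ => (((n : ℝ)⁻¹ : ℝ) : 𝕜) := by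
      ext; simp
    rw [h3] at h2
    have h4 : lpnorm ∞ (fun _ : Fin n => (1 : 𝕜)) = 1 := by simp [lpnorm]
    have h5 : ∑ _i : Fin n, (n : ℝ)⁻¹ = 1 := by simp [hn.ne']
    rw [h4] at h2
    rw [h5] at h1
    linarith

theorem alphaC_le_of_no_isL1PlusSeq {ca cb : ℝ} (hca : 0 ≤ ca) {E : Fam 𝕜}
    (hE : StableFam ca cb E) {p : ℝ} (hp : 1 < p) {δ : ℝ} (hδ : 0 < δ) {N : ℕ}
    (hN : ∀ n, N ≤ n → ∀ P ∈ E n, ¬ IsL1PlusSeq δ P) {n : ℕ} (hn : 0 < n) :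
    alphaC (ENNReal.ofReal p) E n ≤ ca * N + δ * (n : ℝ) ^ (1 - 1 / p) := by
  have hn' : (0 : ℝ) < n := Nat.cast_pos.mpr hn
  refine csInf_le ⟨0, fun S hS => hS.1.le⟩ ⟨by positivity, fun P hP a => ?_⟩
  obtain ⟨f, hf, hfa⟩ := exists_linearMap_norm_le_seminorm P.2 a
  set J : Finset (Fin n) := Finset.univ.filter fun i => δ ≤ ‖f (Pi.single i 1)‖ with hJ
  have hcard : J.card ≤ N := by
    by_contra! hlt
    obtain ⟨Q, hQ, hQ'⟩ := hE.exists_isL1PlusSeq hP hf hδ (J := J) (by simp [hJ])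
    exact hN _ hlt.le Q hQ hQ'
  have hterm : ∀ i, ‖a i * f (Pi.single i 1)‖ ≤
      (if i ∈ J then ca * lpnorm (ENNReal.ofReal p) a else 0) + δ * ‖a i‖ := by
    intro i
    rw [norm_mul, mul_comm]
    split_ifs with hi
    · have := mul_le_mul ((hf _).trans ((hE.1 n P hP).snd_single_le i)) (norm_le_lpnorm hp a i)
        (norm_nonneg _) hca
      have : 0 ≤ δ * ‖a i‖ := by positivity
      linarith
    · rw [zero_add]
      have : ‖f (Pi.single i 1)‖ < δ := by simpa [hJ] using hi
      gcongr
  calc P.2 a ≤ ‖f a‖ := by rw [hfa]; simpa using le_abs_self _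
    _ ≤ ∑ i, ‖a i * f (Pi.single i 1)‖ := by
      rw [linearMap_apply_eq_sum]; exact norm_sum_le _ _
    _ ≤ _ := Finset.sum_le_sum fun i _ => hterm i
    _ = ca * J.card * lpnorm (ENNReal.ofReal p) a + δ * ∑ i, ‖a i‖ := by
      rw [Finset.sum_add_distrib, ← Finset.mul_sum, Finset.sum_ite_mem, Finset.univ_inter,
        Finset.sum_const, nsmul_eq_mul]
      ring
    _ ≤ ca * N * lpnorm (ENNReal.ofReal p) a +
        δ * ((n : ℝ) ^ (1 - 1 / p) * lpnorm (ENNReal.ofReal p) a) := by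
      have := lpnorm_ofReal_nonneg hp a
      gcongr
      exact sum_norm_le_lpnorm hp a
    _ = _ := by ring

theorem tendsto_alphaC_of_no_isL1PlusSeq {ca cb : ℝ} (hca : 0 ≤ ca) {E : Fam 𝕜}
    (hE : StableFam ca cb E)
    (h : ∀ ϱ : ℝ, 0 < ϱ → ∃ N : ℕ, ∀ n : ℕ, N ≤ n → ∀ P ∈ E n, ¬ IsL1PlusSeq ϱ P)
    {p : ℝ} (hp : 1 < p) :
    Filter.Tendsto (fun n : ℕ => (n : ℝ) ^ (1 / p - 1) * alphaC (ENNReal.ofReal p) E n)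
      Filter.atTop (nhds 0) := by
  have hexp : 0 < 1 - 1 / p := by
    rw [sub_pos, div_lt_one (zero_lt_one.trans hp)]
    exact hp
  have hpow : Filter.Tendsto (fun n : ℕ => (n : ℝ) ^ (1 / p - 1)) Filter.atTop (nhds 0) := by
    have := (tendsto_rpow_neg_atTop hexp).comp (tendsto_natCast_atTop_atTop (R := ℝ))
    simpa [Function.comp_def] using this
  refine tendsto_order.mpr ⟨fun c hc => Filter.Eventually.of_forall fun n =>
    hc.trans_le (mul_nonneg (by positivity) (alphaC_nonneg _ _ _)), fun ε hε => ?_⟩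
  obtain ⟨N, hN⟩ := h (ε / 2) (half_pos hε)
  have hlim := hpow.mul_const (ca * N)
  rw [zero_mul] at hlim
  filter_upwards [hlim.eventually_lt_const (half_pos hε), Filter.eventually_gt_atTop 0]
    with n hn hn0
  have hn' : (0 : ℝ) < n := Nat.cast_pos.mpr hn0
  have hone : (n : ℝ) ^ (1 / p - 1) * (n : ℝ) ^ (1 - 1 / p) = 1 := by
    rw [← Real.rpow_add hn']
    simp
  calc (n : ℝ) ^ (1 / p - 1) * alphaC (ENNReal.ofReal p) E n
      ≤ (n : ℝ) ^ (1 / p - 1) * (ca * N + ε / 2 * (n : ℝ) ^ (1 - 1 / p)) := by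
        gcongr
        exact alphaC_le_of_no_isL1PlusSeq hca hE hp (half_pos hε) hN hn0
    _ = (n : ℝ) ^ (1 / p - 1) * (ca * N) +
        ε / 2 * ((n : ℝ) ^ (1 / p - 1) * (n : ℝ) ^ (1 - 1 / p)) := by ring
    _ < ε := by rw [hone]; linarith

end

/-- Theorem 3.2, block basic subtype: for a stable set
`E ⊆ ⋃_{n≥1} B_n^{a,b}` the following are equivalent: block basic subtype `p` for all
`1 < p < ∞`; block basic subtype `p` for some `1 < p < ∞`; block basic subtype
(`θ_n(E) → 0`); and, for every `ϱ > 0`, the absence of `ϱ`-`ℓ₁⁺`-sequences in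
`E ∩ B_n^{a,b}` for all large `n`. -/
theorem block_basic_subtype_tfae {𝕜 : Type*} [RCLike 𝕜]
    (ca cb : ℝ) (hca : 0 ≤ ca) (hcb : 1 ≤ cb)
    (E : Fam 𝕜) (hE : StableFam ca cb E) :
    List.TFAE
      [∀ p : ℝ, 1 < p →
          Filter.Tendsto
            (fun n : ℕ => (n : ℝ) ^ (1 / p - 1) * alphaC (ENNReal.ofReal p) E n)
            Filter.atTop (nhds 0),
        ∃ p : ℝ, 1 < p ∧
          Filter.Tendsto
            (fun n : ℕ => (n : ℝ) ^ (1 / p - 1) * alphaC (ENNReal.ofReal p) E n)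
            Filter.atTop (nhds 0),
        Filter.Tendsto (fun n : ℕ => thetaC E n) Filter.atTop (nhds 0),
        ∀ ϱ : ℝ, 0 < ϱ → ∃ N : ℕ, ∀ n : ℕ, N ≤ n → ∀ P ∈ E n, ¬ IsL1PlusSeq ϱ P] := by
  tfae_have 1 → 2 := fun h => ⟨2, one_lt_two, h 2 one_lt_two⟩
  tfae_have 2 → 3 := fun ⟨p, hp, h⟩ =>
    tendsto_of_tendsto_of_tendsto_of_le_of_le' tendsto_const_nhds h
      (Filter.Eventually.of_forall (thetaC_nonneg E))
      ((Filter.eventually_gt_atTop 0).mono fun n hn => thetaC_le_alphaC hca hE.1 hp hn)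
  tfae_have 3 → 4 := by
    intro h ϱ hϱ
    obtain ⟨N, hN⟩ := Filter.eventually_atTop.mp
      ((h.eventually_lt_const hϱ).and (Filter.eventually_gt_atTop 0))
    exact ⟨N, fun n hn P hP hL =>
      (hN n hn).1.not_ge (hL.le_thetaC hca hE.1 (hN n hn).2 hP)⟩
  tfae_have 4 → 1 := fun h p hp => tendsto_alphaC_of_no_isL1PlusSeq hca hE h hp
  tfae_finish

end AsymSeminorms
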